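/- Let n > 1, d ≥ 2, t be integers with gcd(t,d) = 1, n ≡ t (mod d), and n + d − nd ≤ t ≤ n. Then, modulo [n]_{q^2}·Φ_n(q^2)^2, the sum over k from 0 to (n−t)/d of [2dk+t]_{q^2} · [2dk+t]^2 · (q^{2t};q^{2d})_k^4 / (q^{2d};q^{2d})_k^4 · q^{−4tk} is congruent to −2·[t]^2·[n]_{q^2}·(q^{4t};q^{2d})_{(n−t)/d} / ((1+q^{2t})·(q^{2d};q^{2d})_{(n−t)/d}) · q^{t − 2t(n−t)/d}. -/

import Mathlib

open Polynomial Finset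

/-- The q-shifted factorial `(x; r)_k = (1-x)(1-x r)⋯(1-x r^(k-1))`. -/
noncomputable def qPoch {F : Type*} [Field F] (x r : F) (k : ℕ) : F :=
  ∏ i ∈ Finset.range k, (1 - x * r ^ i)

/-- The q-integer `[z] = (1-q^z)/(1-q)` (for an arbitrary integer `z`). -/
noncomputable def qInt {F : Type*} [Field F] (q : F) (z : ℤ) : F :=
  (1 - q ^ z) / (1 - q)

/-- The rational function `x ∈ ℚ(q)` is ≡ 0 modulo the polynomial `M`:
its numerator in lowest terms is divisible by `M`, i.e. `x = M·f/g` with `g` coprime to `M`. -/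
def ratCongr (M : Polynomial ℚ) (x : RatFunc ℚ) : Prop :=
  ∃ f g : Polynomial ℚ, IsCoprime M g ∧
    x * algebraMap (Polynomial ℚ) (RatFunc ℚ) g =
      algebraMap (Polynomial ℚ) (RatFunc ℚ) M * algebraMap (Polynomial ℚ) (RatFunc ℚ) f

section Summation

variable {K : Type*} [Field K]

lemma qPoch_zero (x r : K) : qPoch x r 0 = 1 := by simp [qPoch]

lemma qPoch_succ (x r : K) (k : ℕ) : qPoch x r (k + 1) = qPoch x r k * (1 - x * r ^ k) := by
  simp [qPoch, Finset.prod_range_succ]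

lemma qPoch_succ_left (x r : K) (k : ℕ) :
    qPoch x r (k + 1) = (1 - x) * qPoch (x * r) r k := by
  simp only [qPoch, Finset.prod_range_succ', pow_zero, mul_one]
  rw [mul_comm]
  congr 1
  refine Finset.prod_congr rfl fun i _ => ?_
  ring

lemma qPoch_ne_zero {x r : K} {k : ℕ} (h : ∀ i < k, 1 - x * r ^ i ≠ 0) : qPoch x r k ≠ 0 :=
  Finset.prod_ne_zero_iff.2 fun i hi => h i (Finset.mem_range.1 hi)

/-- The summand `(a, a, 1/y, a²y; p)_k / (p, p, apy, p/(ay); p)_k` of a very-well-poised series. -/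
noncomputable def wpCoeff (a p y : K) (k : ℕ) : K :=
  qPoch a p k ^ 2 * qPoch (1 / y) p k * qPoch (a ^ 2 * y) p k /
    (qPoch p p k ^ 2 * qPoch (a * p * y) p k * qPoch (p / (a * y)) p k)

lemma wp_contiguous_step {a p y : K} (ha : a ≠ 0) (hp : p ≠ 0) (hy : y ≠ 0) (Y : K) :
    (1-a*y)*(1-p*y)*a*(1-a*Y^2)*(1-1/(p*y))*(1-a^2*y*Y)*(1-a*p*y)*(1-Y/(a*y))
      -(1-a*p*y)*(1-a^2*y)*(1-a*Y^2)*(1-Y/(p*y))*(1-a^2*y)*(1-a*p*y*Y)*(1-1/(a*y))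
    = (1-a*p*y)*(1-a*y)*(1-a^2*p*y^2)*a/(p*y) *
      (p/a^2*(1-a*Y)^2*(1-Y/(p*y))*(1-a^2*y*Y)-(1-Y)^2*(1-a*p*y*Y)*(1-Y/(a*y))) := by
  field_simp
  ring

lemma wp_contiguous {a p y : K} (ha : a ≠ 0) (hp : p ≠ 0) (hy : y ≠ 0)
    (hpj : ∀ j : ℕ, 1 - p * p ^ j ≠ 0) (h1 : ∀ j : ℕ, 1 - a * p * y * p ^ j ≠ 0)
    (h2 : ∀ j : ℕ, 1 - 1 / (a * y) * p ^ j ≠ 0) (k : ℕ) :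
    ∑ j ∈ Finset.range (k + 1),
      ((1 - a * y) * (1 - p * y) * a *
          ((1 - a * (p ^ j) ^ 2) * (p / a ^ 2) ^ j * wpCoeff a p (p * y) j) -
        (1 - a * p * y) * (1 - a ^ 2 * y) *
          ((1 - a * (p ^ j) ^ 2) * (p / a ^ 2) ^ j * wpCoeff a p y j)) =
    (1-a*p*y)*(1-a*y)*(1-a^2*p*y^2)*a/(p*y) * ((p / a ^ 2) ^ (k + 1) *
      (qPoch a p (k + 1) ^ 2 * qPoch (1 / y) p k * qPoch (a ^ 2 * y * p) p k /
        (qPoch p p k ^ 2 * qPoch (a * p * y) p (k + 1) * qPoch (1 / (a * y)) p (k + 1)))) := by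
  have e1 : 1 - a * p * y ≠ 0 := by simpa using h1 0
  have e2 : 1 - 1 / (a * y) ≠ 0 := by simpa using h2 0
  have e3 : 1 - a * y ≠ 0 := by
    intro h
    apply e2
    rw [← sub_eq_zero.1 h, div_one, sub_self]
  induction k with
  | zero =>
    have e4 : 1 - 1 / (a * y) = -(1 - a * y) / (a * y) := by
      field_simp
      ring
    simp only [wpCoeff, qPoch_zero, qPoch_succ, Finset.sum_range_one, zero_add, pow_zero, pow_one,
      mul_one, one_mul, one_pow, div_one]
    rw [e4]
    generalize hx : 1 - a * y = x at *
    generalize hz : 1 - a * p * y = z at *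
    field_simp
    rw [← hx, ← hz]
    ring
  | succ k ih =>
    rw [Finset.sum_range_succ, ih]
    have hP : qPoch p p k ≠ 0 := qPoch_ne_zero fun i _ => hpj i
    have hD : qPoch (a * p * y) p (k + 1) ≠ 0 := qPoch_ne_zero fun i _ => h1 i
    have hE : qPoch (1 / (a * y)) p (k + 1) ≠ 0 := qPoch_ne_zero fun i _ => h2 i
    have hpk := hpj k
    have h1k := h1 (k + 1)
    have h2k := h2 (k + 1)
    have g1 : qPoch (p / (a * y)) p (k + 1) =
        qPoch (1 / (a * y)) p (k + 1) * (1 - 1 / (a * y) * p ^ (k + 1)) / (1 - 1 / (a * y)) := by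
      have h : p / (a * y) = 1 / (a * y) * p := by ring
      rw [eq_div_iff e2, ← qPoch_succ, qPoch_succ_left (1 / (a * y)), h, mul_comm]
    have g2 : qPoch (a * p * (p * y)) p (k + 1) =
        qPoch (a * p * y) p (k + 1) * (1 - a * p * y * p ^ (k + 1)) / (1 - a * p * y) := by
      have h : a * p * (p * y) = a * p * y * p := by ring
      rw [eq_div_iff e1, ← qPoch_succ, qPoch_succ_left (a * p * y), h, mul_comm]
    have g3 : p / (a * (p * y)) = 1 / (a * y) := by field_simp
    have g4 : 1 / (p * y) * p = 1 / y := by field_simp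
    have g5 : a ^ 2 * (p * y) = a ^ 2 * y * p := by ring
    have key := wp_contiguous_step ha hp hy (p ^ (k + 1))
    have g6 : p ^ (k + 1) / (p * y) = 1 / y * p ^ k := by
      rw [pow_succ]
      field_simp
    have g7 : p ^ (k + 1) / (a * y) = 1 / (a * y) * p ^ (k + 1) := by ring
    have g8 : p * p ^ k = p ^ (k + 1) := by ring
    have g9 : a ^ 2 * y * p * p ^ k = a ^ 2 * y * p ^ (k + 1) := by ring
    rw [wpCoeff, wpCoeff, g3, g2, g1, qPoch_succ_left (1 / (p * y)), g4, g5,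
      qPoch_succ_left (a ^ 2 * y), qPoch_succ a p (k + 1), qPoch_succ (1 / y) p k,
      qPoch_succ (a ^ 2 * y * p) p k, qPoch_succ p p k, qPoch_succ (a * p * y) p (k + 1),
      qPoch_succ (1 / (a * y)) p (k + 1), g8, g9, pow_succ (p / a ^ 2) (k + 1)]
    rw [g6, g7] at key
    rw [g8] at hpk
    clear ih g1 g2 g3 g4 g5 g6 g7 g8 g9 h1 h2 hpj
    generalize p ^ (k + 1) = Y at *
    generalize qPoch a p (k + 1) = A at *
    generalize qPoch (1 / y) p k = B at *
    generalize qPoch (a ^ 2 * y * p) p k = C at *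
    generalize qPoch p p k = P at *
    generalize qPoch (a * p * y) p (k + 1) = D at *
    generalize qPoch (1 / (a * y)) p (k + 1) = E at *
    generalize (1-a*p*y)*(1-a*y)*(1-a^2*p*y^2)*a/(p*y) = g at *
    generalize 1 / y * p ^ k = w at *
    generalize (p / a ^ 2) ^ (k + 1) = Z at *
    generalize p / a ^ 2 = ρ at *
    generalize 1 - 1 / (a * y) * Y = w₂ at *
    generalize 1 - 1 / (a * y) = w₀ at *
    generalize 1 - a * p * y * Y = v₂ at *
    generalize 1 - a * p * y = v₀ at *
    generalize 1 - a * y = v₁ at *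
    generalize 1 - 1 / (p * y) = w₁ at *
    generalize 1 - Y = X at *
    clear e3 ha hp hy
    field_simp
    linear_combination (Z * A ^ 2 * B * C) * key

lemma qPoch_one_div_pow_eq_zero {p : K} (hp : p ≠ 0) (N : ℕ) :
    qPoch (1 / p ^ N) p (N + 1) = 0 := by
  rw [qPoch_succ, one_div_mul_cancel (pow_ne_zero _ hp), sub_self, mul_zero]

theorem sum_wpCoeff {a p : K} (ha : a ≠ 0) (hp : p ≠ 0) (hpj : ∀ j : ℕ, 1 - p * p ^ j ≠ 0)
    (haj : ∀ j : ℤ, 1 - a * p ^ j ≠ 0) (N : ℕ) :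
    ∑ k ∈ Finset.range (N + 1), (1 - a * (p ^ k) ^ 2) * (p / a ^ 2) ^ k * wpCoeff a p (p ^ N) k =
      (1 - a * p ^ N) * qPoch (a ^ 2) p N / (qPoch p p N * a ^ N) := by
  induction N with
  | zero => simp [wpCoeff, qPoch_zero]
  | succ N ih =>
    have h1 : ∀ j : ℕ, 1 - a * p * p ^ N * p ^ j ≠ 0 := fun j => by
      have := haj (1 + N + j)
      rwa [zpow_add₀ hp, zpow_add₀ hp, zpow_one, zpow_natCast, zpow_natCast, ← mul_assoc,
        ← mul_assoc] at this
    have h2 : ∀ j : ℕ, 1 - 1 / (a * p ^ N) * p ^ j ≠ 0 := fun j h => by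
      apply haj (N - j)
      rw [zpow_sub₀ hp, zpow_natCast, zpow_natCast]
      field_simp at h ⊢
      linear_combination -h
    have key := wp_contiguous ha hp (pow_ne_zero N hp) hpj h1 h2 (N + 1)
    rw [qPoch_one_div_pow_eq_zero hp, mul_zero, zero_mul, zero_div, mul_zero, mul_zero,
      Finset.sum_sub_distrib, ← Finset.mul_sum, ← Finset.mul_sum,
      Finset.sum_range_succ (fun k => (1 - a * (p ^ k) ^ 2) * (p / a ^ 2) ^ k *
        wpCoeff a p (p ^ N) k) (N + 1), ih] at key
    have hvan : wpCoeff a p (p ^ N) (N + 1) = 0 := by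
      rw [wpCoeff, qPoch_one_div_pow_eq_zero hp, mul_zero, zero_mul, zero_div]
    rw [hvan, mul_zero, add_zero] at key
    have e1 : 1 - a * p ^ N ≠ 0 := by simpa using haj N
    have hP : qPoch p p N ≠ 0 := qPoch_ne_zero fun i _ => hpj i
    have e2 := hpj N
    rw [qPoch_succ p p, qPoch_succ (a ^ 2) p, pow_succ a N]
    have e3 : (1 - a * p ^ N) * (1 - p * p ^ N) * a ≠ 0 := mul_ne_zero (mul_ne_zero e1 e2) ha
    rw [← mul_right_inj' e3, pow_succ' p]
    rw [sub_eq_zero.1 key]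
    generalize 1 - a * p ^ N = v at *
    generalize 1 - p * p ^ N = w at *
    rw [← mul_assoc a p]
    field_simp

lemma wpCoeff_eq_prod {a p y : K} (ha : a ≠ 0) (hy : y ≠ 0) (k : ℕ) :
    wpCoeff a p y k = ∏ i ∈ Finset.range k,
      ((1 - a * p ^ i) ^ 2 * (1 + (a * p ^ i) ^ 2 - a * p ^ i * (a * y + (a * y)⁻¹)) /
        ((1 - p ^ (i + 1)) ^ 2 *
          (1 + (p ^ (i + 1)) ^ 2 - p ^ (i + 1) * (a * y + (a * y)⁻¹)))) := by
  simp only [wpCoeff, qPoch, ← Finset.prod_pow, ← Finset.prod_mul_distrib,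
    ← Finset.prod_div_distrib]
  refine Finset.prod_congr rfl fun i _ => ?_
  congr 1
  · field_simp
    ring
  · field_simp
    ring

lemma sum_wp_telescope {a b p u : K} (hab : a * b = 1) {t : ℕ → K}
    (ht : ∀ k, t (k + 1) * ((1 - p ^ (k + 1)) ^ 2 * (1 + (p ^ (k + 1)) ^ 2 - p ^ (k + 1) * u)) =
      t k * ((1 - a * p ^ k) ^ 2 * (1 + (a * p ^ k) ^ 2 - a * p ^ k * u))) (m : ℕ) :
    (1 - a) * ∑ k ∈ Finset.range m, (1 - a * (p ^ k) ^ 2) * b ^ (2 * k) * t k *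
        ((1 + a) * (1 + a * (p ^ k) ^ 2) - a * p ^ k * (2 + u)) =
      t m * b ^ (2 * m) * a ^ 2 * ((1 - p ^ m) ^ 2 * (1 + (p ^ m) ^ 2 - p ^ m * u)) := by
  induction m with
  | zero => simp
  | succ k ih =>
    rw [Finset.sum_range_succ, mul_add, ih]
    have h := ht k
    have h2 : b ^ (2 * (k + 1)) = b ^ (2 * k) * b ^ 2 := by ring
    have hab2 : a ^ 2 * b ^ 2 = 1 := by rw [← mul_pow, hab, one_pow]
    rw [h2]
    generalize p ^ (k + 1) = Y' at *
    generalize p ^ k = Y at *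
    generalize b ^ (2 * k) = c at *
    linear_combination (-c * b ^ 2 * a ^ 2) * h -
      (c * t k * ((1 - a * Y) ^ 2 * (1 + (a * Y) ^ 2 - a * Y * u))) * hab2

end Summation

section Reflection

/-- The `k`-th term of the deformed sum over `k + l = N`, with the denominators of all terms
cleared; here `b` plays the role of `s⁻²` and `u` is the deformation parameter. -/
def wpNum {R : Type*} [CommRing R] (s b p u : R) (k l : ℕ) : R :=
  (1 - (s * p ^ k) ^ 2) * (1 - s * p ^ k) ^ 2 * b ^ (2 * k) *
    (∏ i ∈ Finset.range k,
      ((1 - s ^ 2 * p ^ i) ^ 2 * (1 + (s ^ 2 * p ^ i) ^ 2 - s ^ 2 * p ^ i * u))) *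
    ∏ i ∈ Finset.range l,
      ((1 - p ^ (k + i + 1)) ^ 2 * (1 + (p ^ (k + i + 1)) ^ 2 - p ^ (k + i + 1) * u))

/-- The deformed sum minus its closed form, with denominators cleared. -/
def wpPoly {R : Type*} [CommRing R] (s b p V u : R) (N : ℕ) : R :=
  ∑ x ∈ Finset.HasAntidiagonal.antidiagonal N, wpNum s b p u x.1 x.2 -
    (∏ i ∈ Finset.range N,
      ((1 - p ^ (i + 1)) ^ 2 * (1 + (p ^ (i + 1)) ^ 2 - p ^ (i + 1) * u))) *
      ((1 - s ^ 2 * p ^ N) * V * (s ^ 2 * (2 + u) - 2 * s * (1 + s ^ 2)))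

lemma map_wpNum {R S : Type*} [CommRing R] [CommRing S] (f : R →+* S) (s b p u : R) (k l : ℕ) :
    f (wpNum s b p u k l) = wpNum (f s) (f b) (f p) (f u) k l := by
  simp [wpNum, map_prod]

lemma map_wpPoly {R S : Type*} [CommRing R] [CommRing S] (f : R →+* S) (s b p V u : R) (N : ℕ) :
    f (wpPoly s b p V u N) = wpPoly (f s) (f b) (f p) (f V) (f u) N := by
  simp [wpPoly, map_prod, map_wpNum, map_ofNat]

lemma wpNum_eq {K : Type*} [Field K] {s b p u : K} {N : ℕ}
    (hD : ∀ i < N, (1 - p ^ (i + 1)) ^ 2 * (1 + (p ^ (i + 1)) ^ 2 - p ^ (i + 1) * u) ≠ 0)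
    {k l : ℕ} (hkl : k + l = N) :
    wpNum s b p u k l =
      (∏ i ∈ Finset.range N,
        ((1 - p ^ (i + 1)) ^ 2 * (1 + (p ^ (i + 1)) ^ 2 - p ^ (i + 1) * u))) *
      ((1 - (s * p ^ k) ^ 2) * (1 - s * p ^ k) ^ 2 * b ^ (2 * k) *
        ∏ i ∈ Finset.range k,
          ((1 - s ^ 2 * p ^ i) ^ 2 * (1 + (s ^ 2 * p ^ i) ^ 2 - s ^ 2 * p ^ i * u) /
            ((1 - p ^ (i + 1)) ^ 2 * (1 + (p ^ (i + 1)) ^ 2 - p ^ (i + 1) * u)))) := by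
  subst hkl
  rw [Finset.prod_range_add, wpNum, Finset.prod_div_distrib]
  have h : ∏ i ∈ Finset.range k,
      ((1 - p ^ (i + 1)) ^ 2 * (1 + (p ^ (i + 1)) ^ 2 - p ^ (i + 1) * u)) ≠ 0 :=
    Finset.prod_ne_zero_iff.2 fun i hi => hD i (by have := Finset.mem_range.1 hi; omega)
  generalize ∏ i ∈ Finset.range k,
    ((1 - p ^ (i + 1)) ^ 2 * (1 + (p ^ (i + 1)) ^ 2 - p ^ (i + 1) * u)) = x at *
  generalize ∏ i ∈ Finset.range k, ((1 - s ^ 2 * p ^ i) ^ 2 *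
    (1 + (s ^ 2 * p ^ i) ^ 2 - s ^ 2 * p ^ i * u)) = y
  generalize ∏ i ∈ Finset.range l, ((1 - p ^ (k + i + 1)) ^ 2 *
    (1 + (p ^ (k + i + 1)) ^ 2 - p ^ (k + i + 1) * u)) = z
  field_simp

theorem wpPoly_eq_zero {K : Type*} [Field K] {s p : K} (hs : s ≠ 0) (hp : p ≠ 0)
    (hpj : ∀ j : ℕ, 1 - p * p ^ j ≠ 0) (haj : ∀ j : ℤ, 1 - s ^ 2 * p ^ j ≠ 0)
    (h1 : 1 + s ^ 2 ≠ 0) (N : ℕ) :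
    wpPoly s (s ^ 2)⁻¹ p
      (qPoch ((s ^ 2) ^ 2) p N / ((1 + s ^ 2) * qPoch p p N * (s ^ 2) ^ N))
      (s ^ 2 * p ^ N + (s ^ 2 * p ^ N)⁻¹) N = 0 := by
  have ha : s ^ 2 ≠ 0 := pow_ne_zero _ hs
  have hD : ∀ i : ℕ, (1 - p ^ (i + 1)) ^ 2 * (1 + (p ^ (i + 1)) ^ 2 -
      p ^ (i + 1) * (s ^ 2 * p ^ N + (s ^ 2 * p ^ N)⁻¹)) ≠ 0 := fun i => by
    have e1 : 1 - p ^ (i + 1) ≠ 0 := by simpa [pow_succ'] using hpj i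
    have e2 := haj (N + i + 1)
    have e3 := haj (N - i - 1)
    rw [zpow_sub₀ hp, zpow_sub₀ hp, zpow_natCast, zpow_natCast, zpow_one] at e3
    have e4 : ((N : ℤ) + i + 1) = ((N + i + 1 : ℕ) : ℤ) := by push_cast; ring
    rw [e4, zpow_natCast] at e2
    have e5 : 1 + (p ^ (i + 1)) ^ 2 - p ^ (i + 1) * (s ^ 2 * p ^ N + (s ^ 2 * p ^ N)⁻¹) =
        -(p ^ (i + 1) * (s ^ 2 * p ^ N)⁻¹) * (1 - s ^ 2 * p ^ (N + i + 1)) *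
          (1 - s ^ 2 * (p ^ N / p ^ i / p)) := by
      field_simp
      ring
    rw [e5]
    have e6 : p ^ (i + 1) * (s ^ 2 * p ^ N)⁻¹ ≠ 0 :=
      mul_ne_zero (pow_ne_zero _ hp) (inv_ne_zero (mul_ne_zero ha (pow_ne_zero _ hp)))
    exact mul_ne_zero (pow_ne_zero _ e1) (mul_ne_zero (mul_ne_zero (neg_ne_zero.2 e6) e2) e3)
  have hsum := sum_wpCoeff ha hp hpj haj N
  have htel := sum_wp_telescope (p := p) (u := s ^ 2 * p ^ N + (s ^ 2 * p ^ N)⁻¹)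
    (mul_inv_cancel₀ ha) (t := wpCoeff (s ^ 2) p (p ^ N)) (fun k => by
      rw [wpCoeff_eq_prod ha (pow_ne_zero _ hp), wpCoeff_eq_prod ha (pow_ne_zero _ hp),
        Finset.prod_range_succ, mul_assoc, div_mul_cancel₀ _ (hD k)]) (N + 1)
  have hvan : wpCoeff (s ^ 2) p (p ^ N) (N + 1) = 0 := by
    rw [wpCoeff, qPoch_one_div_pow_eq_zero hp, mul_zero, zero_mul, zero_div]
  rw [hvan, zero_mul, zero_mul, zero_mul] at htel
  have htel' := (mul_eq_zero.1 htel).resolve_left (by simpa using haj 0)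
  rw [wpPoly, Finset.sum_congr rfl fun x hx => wpNum_eq (fun i _ => hD i)
    (Finset.HasAntidiagonal.mem_antidiagonal.1 hx), ← Finset.mul_sum, ← mul_sub]
  refine mul_eq_zero_of_right _ ?_
  rw [Finset.Nat.sum_antidiagonal_eq_sum_range_succ_mk]
  rw [← mul_right_inj' h1, mul_zero, mul_sub, Finset.mul_sum]
  have e : (1 + s ^ 2) * ((1 - s ^ 2 * p ^ N) *
      (qPoch ((s ^ 2) ^ 2) p N / ((1 + s ^ 2) * qPoch p p N * (s ^ 2) ^ N)) *
      (s ^ 2 * (2 + (s ^ 2 * p ^ N + (s ^ 2 * p ^ N)⁻¹)) - 2 * s * (1 + s ^ 2))) =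
      (s ^ 2 * (2 + (s ^ 2 * p ^ N + (s ^ 2 * p ^ N)⁻¹)) - 2 * s * (1 + s ^ 2)) *
      ((1 - s ^ 2 * p ^ N) * qPoch ((s ^ 2) ^ 2) p N / (qPoch p p N * (s ^ 2) ^ N)) := by
    generalize (s ^ 2 * (2 + (s ^ 2 * p ^ N + (s ^ 2 * p ^ N)⁻¹)) - 2 * s * (1 + s ^ 2)) = w
    generalize qPoch ((s ^ 2) ^ 2) p N = v
    rw [mul_assoc (1 + s ^ 2), div_mul_eq_div_div_swap]
    field_simp
  rw [e, ← hsum, Finset.mul_sum, ← Finset.sum_sub_distrib]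
  rw [← htel']
  refine Finset.sum_congr rfl fun k _ => ?_
  rw [← wpCoeff_eq_prod ha (pow_ne_zero _ hp)]
  have e7 : ((s ^ 2)⁻¹) ^ (2 * k) = ((s ^ 2) ^ (2 * k))⁻¹ := inv_pow _ _
  have e8 : (p / (s ^ 2) ^ 2) ^ k = p ^ k * ((s ^ 2) ^ (2 * k))⁻¹ := by
    rw [div_pow, ← pow_mul (s ^ 2) 2 k, div_eq_mul_inv]
  rw [e7, e8]
  generalize ((s ^ 2) ^ (2 * k))⁻¹ = c
  generalize (s ^ 2 * p ^ N + (s ^ 2 * p ^ N)⁻¹) = u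
  generalize wpCoeff (s ^ 2) p (p ^ N) k = w
  ring

lemma prod_wp_reflect {R : Type*} [CommRing R] {a p : R} (u : R) (k l : ℕ)
    (h : a * p ^ (k + l) = 1) :
    p ^ (2 * k) * ∏ i ∈ Finset.range k,
        ((1 - a * p ^ i) ^ 2 * (1 + (a * p ^ i) ^ 2 - a * p ^ i * u)) =
      a ^ (4 * k) * p ^ (2 * k * k) * ∏ i ∈ Finset.range k,
        ((1 - p ^ (l + i + 1)) ^ 2 * (1 + (p ^ (l + i + 1)) ^ 2 - p ^ (l + i + 1) * u)) := by
  induction k generalizing l with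
  | zero => simp
  | succ k ih =>
    have h1 := ih (l + 1) (by rw [← h]; ring)
    rw [Finset.prod_range_succ, Finset.prod_range_succ', add_zero]
    have e : ∀ i, l + (i + 1) + 1 = l + 1 + i + 1 := fun i => by ring
    simp only [e]
    have hc : (a * p ^ k) * p ^ (l + 1) = 1 := by rw [← h]; ring
    have h2 : (1 - a * p ^ k) ^ 2 * (1 + (a * p ^ k) ^ 2 - a * p ^ k * u) =
        (a * p ^ k) ^ 4 * ((1 - p ^ (l + 1)) ^ 2 * (1 + (p ^ (l + 1)) ^ 2 - p ^ (l + 1) * u)) := by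
      generalize a * p ^ k = c at *
      generalize p ^ (l + 1) = P at *
      have h3 : c ^ 2 * (1 - P) ^ 2 = (1 - c) ^ 2 := by linear_combination (c * P + 1 - 2 * c) * hc
      have h4 : c ^ 2 * (1 + P ^ 2 - P * u) = 1 + c ^ 2 - c * u := by
        linear_combination (c * P + 1 - u * c) * hc
      rw [← h3, ← h4]
      ring
    rw [h2]
    generalize (1 - p ^ (l + 1)) ^ 2 * (1 + (p ^ (l + 1)) ^ 2 - p ^ (l + 1) * u) = E at *
    have e1 : p ^ (2 * (k + 1) * (k + 1)) = p ^ (2 * k * k) * p ^ (4 * k) * p ^ 2 := by ring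
    have e2 : p ^ (2 * (k + 1)) = p ^ (2 * k) * p ^ 2 := by ring
    have e3 : a ^ (4 * (k + 1)) = a ^ (4 * k) * a ^ 4 := by ring
    rw [e1, e2, e3, mul_pow, ← pow_mul, mul_comm k 4]
    linear_combination (p ^ 2 * a ^ 4 * p ^ (4 * k) * E) * h1

lemma wpNum_mul_pow {R : Type*} [CommRing R] {s b p : R} (u : R) (k l : ℕ) (hb : b * s ^ 2 = 1)
    (h : s ^ 2 * p ^ (k + l) = 1) :
    p ^ (2 * k + 2 * k * l) * wpNum s b p u k l =
      (1 - (s * p ^ k) ^ 2) * (1 - s * p ^ k) ^ 2 *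
        ((∏ i ∈ Finset.range k,
          ((1 - p ^ (l + i + 1)) ^ 2 * (1 + (p ^ (l + i + 1)) ^ 2 - p ^ (l + i + 1) * u))) *
        ∏ i ∈ Finset.range l,
          ((1 - p ^ (k + i + 1)) ^ 2 * (1 + (p ^ (k + i + 1)) ^ 2 - p ^ (k + i + 1) * u))) := by
  have h1 := prod_wp_reflect u k l h
  have h2 : b ^ (2 * k) * (s ^ 2) ^ (4 * k) * p ^ (2 * k * k) * p ^ (2 * k * l) = 1 := by
    calc _ = (b * s ^ 2) ^ (2 * k) * (s ^ 2 * p ^ (k + l)) ^ (2 * k) := by ring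
      _ = 1 := by rw [hb, h, one_pow, one_mul]
  rw [wpNum, pow_add]
  generalize (1 - (s * p ^ k) ^ 2) * (1 - s * p ^ k) ^ 2 = c at *
  generalize ∏ i ∈ Finset.range l, ((1 - p ^ (k + i + 1)) ^ 2 *
    (1 + (p ^ (k + i + 1)) ^ 2 - p ^ (k + i + 1) * u)) = x at *
  generalize ∏ i ∈ Finset.range k, ((1 - p ^ (l + i + 1)) ^ 2 *
    (1 + (p ^ (l + i + 1)) ^ 2 - p ^ (l + i + 1) * u)) = y at *
  linear_combination (p ^ (2 * k * l) * c * b ^ (2 * k) * x) * h1 + (c * x * y) * h2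

lemma wpNum_reflect {R : Type*} [CommRing R] {s b p : R} (u : R) (k l : ℕ) (hb : b * s ^ 2 = 1)
    (h : s ^ 2 * p ^ (k + l) = 1) (hp : IsUnit p) :
    wpNum s b p u l k = -wpNum s b p u k l := by
  have h1 := wpNum_mul_pow u k l hb h
  have h2 := wpNum_mul_pow u l k hb (by rwa [add_comm])
  rw [mul_comm (∏ i ∈ Finset.range l, _)] at h2
  have h3 : p ^ (2 * k + 2 * k * l) = p ^ (2 * l + 2 * l * k) * (s * p ^ k) ^ 4 := by
    calc _ = p ^ (2 * k + 2 * k * l) * (s ^ 2 * p ^ (k + l)) ^ 2 := by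
          rw [h, one_pow, mul_one]
      _ = _ := by ring
  have h4 : (s * p ^ k) * (s * p ^ l) = 1 := by rw [← h]; ring
  rw [← (hp.pow (2 * k + 2 * k * l)).mul_right_inj, mul_neg, h1, h3, mul_right_comm, h2]
  generalize s * p ^ k = z at *
  generalize s * p ^ l = w at *
  have h5 : (1 - w) ^ 2 * z ^ 2 = (1 - z) ^ 2 := by linear_combination (z * w + 1 - 2 * z) * h4
  have h6 : (1 - w ^ 2) * z ^ 2 = -(1 - z ^ 2) := by linear_combination (-z * w - 1) * h4
  linear_combination ((1 - w ^ 2) * z ^ 2 * (∏ i ∈ Finset.range k,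
          ((1 - p ^ (l + i + 1)) ^ 2 * (1 + (p ^ (l + i + 1)) ^ 2 - p ^ (l + i + 1) * u))) *
        ∏ i ∈ Finset.range l,
          ((1 - p ^ (k + i + 1)) ^ 2 * (1 + (p ^ (k + i + 1)) ^ 2 - p ^ (k + i + 1) * u))) * h5 +
      ((1 - z) ^ 2 * (∏ i ∈ Finset.range k,
          ((1 - p ^ (l + i + 1)) ^ 2 * (1 + (p ^ (l + i + 1)) ^ 2 - p ^ (l + i + 1) * u))) *
        ∏ i ∈ Finset.range l,
          ((1 - p ^ (k + i + 1)) ^ 2 * (1 + (p ^ (k + i + 1)) ^ 2 - p ^ (k + i + 1) * u))) * h6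

theorem sum_wpNum_eq_zero {R : Type*} [CommRing R] (h2 : IsUnit (2 : R)) {s b p : R} (u : R)
    {r : ℕ} (hb : b * s ^ 2 = 1) (h : s ^ 2 * p ^ r = 1) (hp : IsUnit p) :
    ∑ x ∈ Finset.HasAntidiagonal.antidiagonal r, wpNum s b p u x.1 x.2 = 0 := by
  rw [← h2.mul_right_eq_zero, two_mul]
  nth_rewrite 1 [← Finset.Nat.sum_antidiagonal_swap]
  rw [← Finset.sum_add_distrib]
  refine Finset.sum_eq_zero fun x hx => ?_
  rw [Prod.fst_swap, Prod.snd_swap, wpNum_reflect u x.1 x.2 hb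
    (by rwa [Finset.HasAntidiagonal.mem_antidiagonal.1 hx]) hp, neg_add_cancel]

theorem dvd_wpPoly {R : Type*} [CommRing R] (h2 : IsUnit (2 : R)) {φ s b p : R} {N : ℕ}
    (hb : b * s ^ 2 = 1) (h : φ ∣ 1 - s ^ 2 * p ^ N) (hp : IsUnit p) (V u : R) :
    φ ∣ wpPoly s b p V u N := by
  let π := Ideal.Quotient.mk (Ideal.span {φ})
  have hsp : π s ^ 2 * π p ^ N = 1 := by
    rw [← Ideal.mem_span_singleton, ← Ideal.Quotient.eq_zero_iff_mem, map_sub, map_one, map_mul,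
      map_pow, map_pow] at h
    exact (sub_eq_zero.1 h).symm
  rw [← Ideal.mem_span_singleton, ← Ideal.Quotient.eq_zero_iff_mem, map_wpPoly, wpPoly, hsp,
    sub_self, zero_mul, zero_mul, mul_zero, sub_zero]
  refine sum_wpNum_eq_zero ?_ _ ?_ hsp (hp.map π)
  · rw [← map_ofNat π 2]
    exact h2.map π
  · rw [← map_pow, ← map_mul, hb, map_one]

end Reflection

section Local

/-- `A` behaves like the localization of a ring of polynomials in `Q` at the `m`-th cyclotomic
polynomial `φ = Φ_m(Q)`. -/
structure LocalData {K : Type*} [Field K] (A : Subring K) (φ Q : K) (m : ℕ) : Prop where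
  one_lt : 1 < m
  base_ne_zero : Q ≠ 0
  zpow_mem : ∀ j : ℤ, Q ^ j ∈ A
  zpow_ne_one : ∀ j : ℤ, j ≠ 0 → Q ^ j ≠ 1
  mem : φ ∈ A
  ne_zero : φ ≠ 0
  inv_mem : ∀ e : ℕ, e ≠ 0 → ∀ y ∈ A, ((e : K) + φ * y)⁻¹ ∈ A
  inv_one_sub_mem : ∀ j : ℤ, ¬ (m : ℤ) ∣ j → (1 - Q ^ j)⁻¹ ∈ A
  exists_eq_mul : ∃ c ∈ A, 1 - Q ^ (m : ℤ) = φ * c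

namespace LocalData

variable {K : Type*} [Field K] {A : Subring K} {φ Q : K} {m : ℕ}

lemma one_sub_natCast_mul (h : LocalData A φ Q m) (c : ℕ) :
    ∃ y ∈ A, 1 - Q ^ ((m : ℤ) * c) = (1 - Q ^ (m : ℤ)) * (c + φ * y) := by
  have hQ := h.base_ne_zero
  obtain ⟨z, hz, e⟩ := h.exists_eq_mul
  induction c with
  | zero => exact ⟨0, zero_mem A, by simp⟩
  | succ c ih =>
    obtain ⟨y, hy, e1⟩ := ih
    refine ⟨Q ^ (m : ℤ) * y - z * c, sub_mem (mul_mem (h.zpow_mem _) hy)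
      (mul_mem hz (natCast_mem A c)), ?_⟩
    have e2 : Q ^ ((m : ℤ) * ((c + 1 : ℕ) : ℤ)) = Q ^ ((m : ℤ) * c) * Q ^ (m : ℤ) := by
      rw [← zpow_add₀ hQ, Nat.cast_succ, mul_add, mul_one]
    rw [e2]
    generalize Q ^ (m : ℤ) = x at *
    push_cast
    linear_combination x * e1 - (1 - x) * c * e

lemma exists_one_sub_zpow (h : LocalData A φ Q m) (c : ℤ) :
    ∃ y ∈ A, 1 - Q ^ ((m : ℤ) * c) = φ * y := by
  have hQ := h.base_ne_zero
  obtain ⟨z, hz, e⟩ := h.exists_eq_mul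
  obtain ⟨c, rfl | rfl⟩ := c.eq_nat_or_neg
  · obtain ⟨y, hy, e1⟩ := h.one_sub_natCast_mul c
    exact ⟨z * (c + φ * y), mul_mem hz (add_mem (natCast_mem A c) (mul_mem h.mem hy)), by
      rw [e1, e, mul_assoc]⟩
  · obtain ⟨y, hy, e1⟩ := h.one_sub_natCast_mul c
    refine ⟨-Q ^ ((m : ℤ) * -c) * (z * (c + φ * y)), mul_mem (neg_mem (h.zpow_mem _))
      (mul_mem hz (add_mem (natCast_mem A c) (mul_mem h.mem hy))), ?_⟩
    have e2 : Q ^ ((m : ℤ) * -c) * Q ^ ((m : ℤ) * c) = 1 := by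
      rw [← zpow_add₀ hQ]
      simp
    rw [e] at e1
    linear_combination (-Q ^ ((m : ℤ) * -c)) * e1 - e2

lemma ratio_mem (h : LocalData A φ Q m) (c : ℤ) (e : ℕ) (he : e ≠ 0) :
    (1 - Q ^ ((m : ℤ) * c)) / (1 - Q ^ ((m : ℤ) * e)) ∈ A := by
  have hQ := h.base_ne_zero
  have hm := h.one_lt
  have key : ∀ c : ℕ, (1 - Q ^ ((m : ℤ) * c)) / (1 - Q ^ ((m : ℤ) * e)) ∈ A := fun c => by
    obtain ⟨y, hy, e1⟩ := h.one_sub_natCast_mul c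
    obtain ⟨z, hz, e2⟩ := h.one_sub_natCast_mul e
    have h1 : 1 - Q ^ (m : ℤ) ≠ 0 := sub_ne_zero.2 (h.zpow_ne_one _ (by omega)).symm
    rw [e1, e2, mul_div_mul_left _ _ h1, div_eq_mul_inv]
    exact mul_mem (add_mem (natCast_mem A c) (mul_mem h.mem hy)) (h.inv_mem e he z hz)
  obtain ⟨c, rfl | rfl⟩ := c.eq_nat_or_neg
  · exact key c
  · have e2 : Q ^ ((m : ℤ) * -c) * Q ^ ((m : ℤ) * c) = 1 := by
      rw [← zpow_add₀ hQ]
      simp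
    have e3 : 1 - Q ^ ((m : ℤ) * -c) = -Q ^ ((m : ℤ) * -c) * (1 - Q ^ ((m : ℤ) * c)) := by
      linear_combination -e2
    rw [e3, mul_div_assoc]
    exact mul_mem (neg_mem (h.zpow_mem _)) (key c)

lemma inv_one_sub_pow_mem (h : LocalData A φ Q m) {d : ℕ} (hd : Nat.Coprime d m) {j : ℕ}
    (hj : ¬ m ∣ j) : (1 - (Q ^ (d : ℤ)) ^ j)⁻¹ ∈ A := by
  rw [← zpow_natCast, ← zpow_mul]
  refine h.inv_one_sub_mem _ fun hdvd => hj ?_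
  have : m ∣ d * j := by exact_mod_cast hdvd
  exact hd.symm.dvd_of_dvd_mul_left this

lemma one_sub_pow_ne_zero (h : LocalData A φ Q m) {d : ℕ} (hd : d ≠ 0) {j : ℕ}
    (hj : j ≠ 0) : 1 - (Q ^ (d : ℤ)) ^ j ≠ 0 := by
  rw [← zpow_natCast, ← zpow_mul]
  exact sub_ne_zero.2 (h.zpow_ne_one _ (by positivity)).symm

/-- Splitting off one block of `c` factors from a quotient of `q`-shifted factorials. -/
lemma qPoch_div_add (x p : K) (k c : ℕ) :
    qPoch x p (k + c) / qPoch p p (k + c) = qPoch x p k / qPoch p p k *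
      ((∏ j ∈ Finset.range c, (1 - x * p ^ (k + j))) *
        ∏ j ∈ Finset.range c, (1 - p ^ (k + j + 1))⁻¹) := by
  have e : ∀ j, p * p ^ (k + j) = p ^ (k + j + 1) := fun j => by ring
  rw [qPoch, qPoch, Finset.prod_range_add, Finset.prod_range_add, mul_div_mul_comm]
  simp only [e, Finset.prod_inv_distrib, div_eq_mul_inv, qPoch]

lemma prod_inv_one_sub_mem (h : LocalData A φ Q m) {d : ℕ} (hd : Nat.Coprime d m) (i c : ℕ)
    (hc : c < m) :
    ∏ j ∈ Finset.range c, (1 - (Q ^ (d : ℤ)) ^ (i * m + j + 1))⁻¹ ∈ A :=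
  prod_mem fun j hj => h.inv_one_sub_pow_mem hd fun hdvd => by
    rw [add_assoc] at hdvd
    have := Nat.le_of_dvd (by omega) ((Nat.dvd_add_right (Dvd.intro_left i rfl)).1 hdvd)
    have := Finset.mem_range.1 hj
    omega

lemma qPoch_div_mul_mem (h : LocalData A φ Q m) {d : ℕ} (hd : Nat.Coprime d m) (e : ℤ) (i : ℕ) :
    qPoch (Q ^ e) (Q ^ (d : ℤ)) (i * m) / qPoch (Q ^ (d : ℤ)) (Q ^ (d : ℤ)) (i * m) ∈ A := by
  have hQ := h.base_ne_zero
  have hm := h.one_lt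
  induction i with
  | zero => simp [qPoch, one_mem]
  | succ i ih =>
    rw [Nat.succ_mul, qPoch_div_add]
    refine mul_mem ih ?_
    have hcop : IsCoprime (d : ℤ) (m : ℤ) := Nat.isCoprime_iff_coprime.2 hd
    obtain ⟨f, g, hfg⟩ := hcop
    obtain ⟨j, hj⟩ : ∃ j : ℕ, (j : ℤ) = (-e * f) % m :=
      ⟨((-e * f) % m).toNat, Int.toNat_of_nonneg (Int.emod_nonneg _ (by omega))⟩
    have hjm : j < m := by
      have := Int.emod_lt_of_pos (-e * f) (by omega : (0 : ℤ) < m)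
      omega
    obtain ⟨c, hc⟩ : ∃ c : ℤ, e + d * (i * m + j : ℕ) = m * c := by
      have := Int.emod_add_mul_ediv (-e * f) m
      refine ⟨d * i + e * g - d * ((-e * f) / m), ?_⟩
      push_cast
      rw [hj]
      linear_combination d * this - e * hfg
    have hnum : 1 - Q ^ e * (Q ^ (d : ℤ)) ^ (i * m + j) = 1 - Q ^ ((m : ℤ) * c) := by
      rw [← zpow_natCast, ← zpow_mul, ← zpow_add₀ hQ, hc]
    obtain ⟨l, rfl⟩ : ∃ l, m = l + 1 := ⟨m - 1, by omega⟩
    rw [Finset.prod_range_succ (fun j => (1 - (Q ^ (d : ℤ)) ^ (i * (l + 1) + j + 1))⁻¹),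
      ← Finset.mul_prod_erase _ _ (Finset.mem_range.2 hjm), hnum]
    have hden : (Q ^ (d : ℤ)) ^ (i * (l + 1) + l + 1) =
        Q ^ (((l + 1 : ℕ) : ℤ) * (d * (i + 1) : ℕ)) := by
      rw [← zpow_natCast, ← zpow_mul]
      congr 1
      push_cast
      ring
    have hd0 : d ≠ 0 := by
      rintro rfl
      rw [Nat.coprime_zero_left] at hd
      omega
    have hr := h.ratio_mem c (d * (i + 1)) (by positivity)
    rw [div_eq_mul_inv, ← hden] at hr
    have hu := h.prod_inv_one_sub_mem hd i l (by omega)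
    have hn : ∏ x ∈ (Finset.range (l + 1)).erase j,
        (1 - Q ^ e * (Q ^ (d : ℤ)) ^ (i * (l + 1) + x)) ∈ A :=
      prod_mem fun x _ => sub_mem (one_mem A) (mul_mem (h.zpow_mem e) (pow_mem (h.zpow_mem d) _))
    convert mul_mem hr (mul_mem hn hu) using 1
    ring

lemma qPoch_div_mem (h : LocalData A φ Q m) {d : ℕ} (hd : Nat.Coprime d m) (e : ℤ) (k : ℕ) :
    qPoch (Q ^ e) (Q ^ (d : ℤ)) k / qPoch (Q ^ (d : ℤ)) (Q ^ (d : ℤ)) k ∈ A := by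
  have hm := h.one_lt
  rw [← Nat.div_add_mod' k m, qPoch_div_add]
  exact mul_mem (h.qPoch_div_mul_mem hd e _) (mul_mem
    (prod_mem fun x _ => sub_mem (one_mem A) (mul_mem (h.zpow_mem e) (pow_mem (h.zpow_mem d) _)))
    (h.prod_inv_one_sub_mem hd _ _ (Nat.mod_lt _ (by omega))))

lemma closedForm_mem (h : LocalData A φ Q m) {d : ℕ} (hd : Nat.Coprime d m) (t : ℤ) (N : ℕ)
    (hN : (m : ℤ) ∣ t + d * N) (h1 : 1 + Q ^ t ≠ 0) :
    qPoch ((Q ^ t) ^ 2) (Q ^ (d : ℤ)) N /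
      ((1 + Q ^ t) * qPoch (Q ^ (d : ℤ)) (Q ^ (d : ℤ)) N * (Q ^ t) ^ N) ∈ A := by
  have hQ := h.base_ne_zero
  have e1 : (Q ^ t) ^ 2 = Q ^ (2 * t) := by
    rw [← zpow_natCast, ← zpow_mul, mul_comm]
    rfl
  have e2 : ((Q ^ t) ^ N)⁻¹ ∈ A := by
    rw [← zpow_natCast, ← zpow_mul, ← zpow_neg]
    exact h.zpow_mem _
  by_cases hm : m ∣ N
  · have ht : (m : ℤ) ∣ t := by
      have : (m : ℤ) ∣ d * N := Dvd.dvd.mul_left (by exact_mod_cast hm) _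
      exact (dvd_add_left this).1 hN
    obtain ⟨c, rfl⟩ := ht
    obtain ⟨y, hy, e3⟩ := h.exists_one_sub_zpow c
    have e4 : (1 + Q ^ ((m : ℤ) * c))⁻¹ ∈ A := by
      have := h.inv_mem 2 two_ne_zero (-y) (neg_mem hy)
      rwa [mul_neg, ← e3, show ((2 : ℕ) : K) + -(1 - Q ^ ((m : ℤ) * c)) = 1 + Q ^ ((m : ℤ) * c) by
        push_cast; ring] at this
    rw [e1]
    convert mul_mem (mul_mem e4 e2) (h.qPoch_div_mem hd (2 * (m * c)) N) using 1
    rw [div_eq_mul_inv, mul_inv, mul_inv]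
    ring
  · obtain ⟨N, rfl⟩ : ∃ M, N = M + 1 :=
      Nat.exists_eq_succ_of_ne_zero (by rintro rfl; exact hm (dvd_zero m))
    have e3 : (Q ^ t) ^ 2 * Q ^ (d : ℤ) = Q ^ (2 * t + d) := by rw [e1, ← zpow_add₀ hQ]
    have e4 := h.inv_one_sub_pow_mem hd hm
    have e5 : 1 - (Q ^ t) ^ 2 = (1 + Q ^ t) * (1 - Q ^ t) := by ring
    rw [qPoch_succ_left, e5, e3, qPoch_succ, ← pow_succ', mul_assoc (1 + Q ^ t),
      mul_assoc (1 + Q ^ t), mul_div_mul_left _ _ h1]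
    convert mul_mem (mul_mem (mul_mem e4 e2) (h.qPoch_div_mem hd (2 * t + d) N))
      (sub_mem (one_mem A) (h.zpow_mem t)) using 1
    rw [div_eq_mul_inv, mul_inv, mul_inv]
    ring

end LocalData

lemma sum_range_of_blocks {R : Type*} [CommRing R] {f B τ : ℕ → R} {m r : ℕ} (hr : r < m)
    (hτ : ∑ c ∈ Finset.range (r + 1), τ c = 0) (hτ0 : ∀ c, r < c → c < m → τ c = 0)
    (hf : ∀ i c, c < m → f (i * m + c) = B i * τ c) (i : ℕ) :
    ∑ k ∈ Finset.range (i * m + r + 1), f k = 0 := by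
  have hfull : ∀ i, ∑ k ∈ Finset.range (i * m), f k = 0 := fun i => by
    induction i with
    | zero => simp
    | succ i ih =>
      rw [Nat.succ_mul, Finset.sum_range_add, ih, zero_add,
        Finset.sum_congr rfl fun c hc => hf i c (Finset.mem_range.1 hc), ← Finset.mul_sum,
        ← Finset.sum_subset (Finset.range_subset_range.2 (Nat.succ_le_of_lt hr))
          fun c hc hc' => hτ0 c (by simpa using hc') (Finset.mem_range.1 hc), hτ, mul_zero]
  rw [add_assoc, Finset.sum_range_add, hfull, zero_add,
    Finset.sum_congr rfl fun c hc => hf i c (by have := Finset.mem_range.1 hc; omega),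
    ← Finset.mul_sum, hτ, mul_zero]

/-- At `u = 2`, the antisymmetry of the deformed sum under reflection makes the undeformed sum
vanish. -/
lemma sum_wellPoised_eq_zero {R : Type*} [CommRing R] (h2 : IsUnit (2 : R)) {s b p : R}
    {r : ℕ} (hb : b * s ^ 2 = 1) (h : s ^ 2 * p ^ r = 1) (hp : IsUnit p) (γ : ℕ → R)
    (hu : ∀ j < r, IsUnit (1 - p ^ (j + 1)))
    (hγ : ∀ c ≤ r, γ c * ∏ j ∈ Finset.range c, (1 - p ^ (j + 1)) =
      ∏ j ∈ Finset.range c, (1 - s ^ 2 * p ^ j)) :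
    ∑ c ∈ Finset.range (r + 1),
      (1 - (s * p ^ c) ^ 2) * (1 - s * p ^ c) ^ 2 * b ^ (2 * c) * γ c ^ 4 = 0 := by
  have hU : IsUnit ((∏ j ∈ Finset.range r, (1 - p ^ (j + 1))) ^ 4) :=
    (IsUnit.prod_iff.2 fun j hj => hu j (Finset.mem_range.1 hj)).pow 4
  rw [← hU.mul_left_eq_zero, Finset.sum_mul, ← sum_wpNum_eq_zero h2 2 hb h hp,
    Finset.Nat.sum_antidiagonal_eq_sum_range_succ_mk]
  refine Finset.sum_congr rfl fun c hc => ?_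
  have hc : c ≤ r := Nat.le_of_lt_succ (Finset.mem_range.1 hc)
  obtain ⟨l, rfl⟩ := Nat.exists_eq_add_of_le hc
  have e : ∀ x : R, (1 - x) ^ 2 * (1 + x ^ 2 - x * 2) = (1 - x) ^ 4 := fun x => by ring
  simp only [wpNum, e, Finset.prod_pow, add_tsub_cancel_left]
  rw [← hγ c hc, Finset.prod_range_add]
  ring

/-- The well-poised sum over `0 ≤ k ≤ i * m + r` vanishes in a ring in which `p` is a primitive
`m`-th root of unity; `g k` plays the role of `(s²; p)_k / (p; p)_k`. -/
lemma sum_wellPoised_blocks_eq_zero {R : Type*} [CommRing R] (h2 : IsUnit (2 : R)) {s b p : R}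
    {r m : ℕ} (hr : r < m) (hb : b * s ^ 2 = 1) (h : s ^ 2 * p ^ r = 1) (hp : IsUnit p)
    (hpm : p ^ m = 1) (hu : ∀ j, j ≠ 0 → j < m → IsUnit (1 - p ^ j)) (g : ℕ → R) (hg0 : g 0 = 1)
    (hg : ∀ k, g (k + 1) * (1 - p ^ (k + 1)) = g k * (1 - s ^ 2 * p ^ k)) (i : ℕ) :
    ∑ k ∈ Finset.range (i * m + r + 1),
      (1 - (s * p ^ k) ^ 2) * (1 - s * p ^ k) ^ 2 * b ^ (2 * k) * g k ^ 4 = 0 := by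
  have hpi : ∀ i, p ^ (i * m) = 1 := fun i => by rw [mul_comm, pow_mul, hpm, one_pow]
  have hγ : ∀ c, g c * ∏ j ∈ Finset.range c, (1 - p ^ (j + 1)) =
      ∏ j ∈ Finset.range c, (1 - s ^ 2 * p ^ j) := fun c => by
    induction c with
    | zero => simp [hg0]
    | succ c ih =>
      rw [Finset.prod_range_succ, Finset.prod_range_succ, ← ih, mul_left_comm, mul_comm, hg]
      ring
  have hblock : ∀ i c, c < m → g (i * m + c) = g (i * m) * g c := fun i c hc => by
    induction c with
    | zero => rw [add_zero, hg0, mul_one]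
    | succ c ih =>
      have h1 := hg (i * m + c)
      rw [add_assoc (i * m), pow_add p (i * m), pow_add p (i * m), hpi, one_mul, one_mul,
        ih (by omega), mul_assoc, ← hg c, ← mul_assoc] at h1
      exact (hu (c + 1) c.succ_ne_zero hc).mul_right_cancel h1
  have hvan : ∀ c, r < c → c < m → g c = 0 := fun c hrc hc => by
    have h1 := hγ c
    have h3 : ∏ j ∈ Finset.range c, (1 - s ^ 2 * p ^ j) = 0 :=
      Finset.prod_eq_zero (Finset.mem_range.2 hrc) (by rw [h, sub_self])
    rw [h3] at h1
    refine (IsUnit.prod_iff.2 fun j hj => hu (j + 1) j.succ_ne_zero ?_).mul_left_eq_zero.1 h1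
    have := Finset.mem_range.1 hj
    omega
  refine sum_range_of_blocks (B := fun i => b ^ (2 * (i * m)) * g (i * m) ^ 4)
    (τ := fun c => (1 - (s * p ^ c) ^ 2) * (1 - s * p ^ c) ^ 2 * b ^ (2 * c) * g c ^ 4) hr
    (sum_wellPoised_eq_zero h2 hb h hp g (fun j hj => hu _ j.succ_ne_zero (by omega))
      fun c _ => hγ c) (fun c h1 h2 => ?_) (fun i c hc => ?_) i
  · rw [hvan c h1 h2, zero_pow four_ne_zero, mul_zero]
  · rw [hblock i c hc, pow_add, hpi, one_mul]
    ring

section Defect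

variable {K : Type*} [Field K]

/-- The summand of the very-well-poised sum. -/
noncomputable def wpTerm (s p : K) (k : ℕ) : K :=
  (1 - (s * p ^ k) ^ 2) * (1 - s * p ^ k) ^ 2 * ((s ^ 2)⁻¹) ^ (2 * k) *
    (qPoch (s ^ 2) p k / qPoch p p k) ^ 4

/-- The quotient of `q`-shifted factorials in the closed form of the very-well-poised sum. -/
noncomputable def wpValue (s p : K) (N : ℕ) : K :=
  qPoch ((s ^ 2) ^ 2) p N / ((1 + s ^ 2) * qPoch p p N * (s ^ 2) ^ N)

/-- The difference between the very-well-poised sum and its closed form. -/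
noncomputable def wpDefect (s p : K) (N : ℕ) : K :=
  ∑ k ∈ Finset.range (N + 1), wpTerm s p k -
    (1 - s ^ 2 * p ^ N) * wpValue s p N * (s ^ 2 * (2 + 2) - 2 * s * (1 + s ^ 2))

lemma wpPoly_two {s p : K} {N : ℕ} (hp : ∀ i < N, 1 - p ^ (i + 1) ≠ 0) :
    wpPoly s (s ^ 2)⁻¹ p (wpValue s p N) 2 N =
      (∏ i ∈ Finset.range N, (1 - p ^ (i + 1)) ^ 4) * wpDefect s p N := by
  have e : ∀ x : K, (1 - x) ^ 2 * (1 + x ^ 2 - x * 2) = (1 - x) ^ 4 := fun x => by ring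
  have e' : ∀ i, p * p ^ i = p ^ (i + 1) := fun i => by ring
  rw [wpPoly, wpDefect, Finset.sum_congr rfl fun x hx => wpNum_eq (fun i hi => by
      rw [e]
      exact pow_ne_zero _ (hp i hi))
    (Finset.HasAntidiagonal.mem_antidiagonal.1 hx), ← Finset.mul_sum, ← mul_sub,
    Finset.Nat.sum_antidiagonal_eq_sum_range_succ_mk]
  simp only [e, wpTerm, qPoch, ← Finset.prod_div_distrib, ← Finset.prod_pow, div_pow, e']

end Defect

namespace LocalData

variable {K : Type*} [Field K] {A : Subring K} {φ Q : K} {m : ℕ}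

lemma isUnit_of_inv_mem {x : A} (hx : (x : K) ≠ 0) (hx' : (x : K)⁻¹ ∈ A) : IsUnit x :=
  IsUnit.of_mul_eq_one ⟨_, hx'⟩ (Subtype.ext (mul_inv_cancel₀ hx))

theorem exists_wpDefect_eq_mul (h : LocalData A φ Q m) {d : ℕ} (hd : Nat.Coprime d m)
    {t : ℤ} {N : ℕ} (hN : (m : ℤ) ∣ t + d * N) {s : K} (hs : s ∈ A) (hst : s ^ 2 = Q ^ t)
    (h1 : 1 + s ^ 2 ≠ 0) (h2 : (2 : K) ≠ 0) : ∃ y ∈ A, wpDefect s (Q ^ (d : ℤ)) N = φ * y := by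
  have hQ := h.base_ne_zero
  have hm := h.one_lt
  obtain ⟨w, hw⟩ := hN
  have hd0 : d ≠ 0 := by
    rintro rfl
    rw [Nat.coprime_zero_left] at hd
    omega
  have hV : wpValue s (Q ^ (d : ℤ)) N ∈ A := by
    rw [wpValue, hst]
    exact h.closedForm_mem hd t N ⟨w, hw⟩ (hst ▸ h1)
  obtain ⟨z, hz, e⟩ := h.exists_one_sub_zpow w
  have hβ := fun k => h.qPoch_div_mem hd t k
  have hb : (s ^ 2)⁻¹ ∈ A := by
    rw [hst, ← zpow_neg]
    exact h.zpow_mem _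
  have haN : ∀ k : ℕ, s ^ 2 * (Q ^ (d : ℤ)) ^ k = Q ^ (t + d * k) := fun k => by
    rw [hst, ← zpow_natCast, ← zpow_mul, ← zpow_add₀ hQ]
  rw [← hst] at hβ
  have hs0 : s ^ 2 ≠ 0 := hst ▸ zpow_ne_zero _ hQ
  set p := Q ^ (d : ℤ) with hpdef
  have hp : p ∈ A := h.zpow_mem _
  let π := Ideal.Quotient.mk (Ideal.span {(⟨φ, h.mem⟩ : A)})
  have hπ : ∀ x : A, π x = 0 ↔ ∃ y ∈ A, (x : K) = φ * y := fun x => by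
    rw [Ideal.Quotient.eq_zero_iff_mem, Ideal.mem_span_singleton]
    exact ⟨fun ⟨c, hc⟩ => ⟨c, c.2, congrArg Subtype.val hc⟩,
      fun ⟨c, hc, e⟩ => ⟨⟨c, hc⟩, Subtype.ext e⟩⟩
  have hπ1 : ∀ x : A, (∃ c : ℤ, (x : K) = Q ^ ((m : ℤ) * c)) → π x = 1 := fun x ⟨c, hc⟩ => by
    rw [← sub_eq_zero, ← neg_eq_zero, neg_sub, ← map_one π, ← map_sub, hπ]
    obtain ⟨y, hy, e⟩ := h.exists_one_sub_zpow c
    exact ⟨y, hy, by rw [← e, ← hc]; rfl⟩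
  have hsum := sum_wellPoised_blocks_eq_zero (R := A ⧸ Ideal.span {(⟨φ, h.mem⟩ : A)})
    (s := π ⟨s, hs⟩) (b := π ⟨_, hb⟩) (p := π ⟨p, hp⟩) (r := N % m) (m := m)
    (by
      rw [← map_ofNat π 2]
      refine (isUnit_of_inv_mem (x := (2 : A)) h2 ?_).map π
      have h3 := h.inv_mem 2 two_ne_zero 0 (zero_mem A)
      rw [mul_zero, add_zero] at h3
      exact h3)
    (Nat.mod_lt _ (by omega))
    (by
      rw [← map_pow, ← map_mul, ← map_one π]
      exact congrArg π (Subtype.ext (inv_mul_cancel₀ hs0)))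
    (by
      rw [← map_pow, ← map_pow, ← map_mul]
      refine hπ1 _ ⟨w - d * (N / m : ℕ), ?_⟩
      refine (haN _).trans (congrArg _ ?_)
      have : ((N / m : ℕ) : ℤ) * m + (N % m : ℕ) = N := by exact_mod_cast Nat.div_add_mod' N m
      linear_combination hw + (d : ℤ) * this)
    ((isUnit_of_inv_mem (x := (⟨p, hp⟩ : A)) (zpow_ne_zero _ hQ)
      (by
        change p⁻¹ ∈ A
        rw [hpdef, ← zpow_neg]
        exact h.zpow_mem _)).map π)
    (by
      rw [← map_pow]
      refine hπ1 _ ⟨d, ?_⟩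
      change p ^ m = _
      rw [hpdef, ← zpow_natCast, ← zpow_mul, mul_comm])
    (fun j hj hjm => by
      rw [← map_pow, ← map_one π, ← map_sub]
      exact (isUnit_of_inv_mem (x := 1 - (⟨p, hp⟩ : A) ^ j) (h.one_sub_pow_ne_zero hd0 hj)
        (h.inv_one_sub_pow_mem hd fun hdvd => by
          have := Nat.le_of_dvd (by omega) hdvd
          omega)).map π)
    (fun k => π ⟨_, hβ k⟩)
    (by
      rw [← map_one π]
      exact congrArg π (Subtype.ext (by simp [qPoch])))
    (fun k => by
      simp only [← map_pow, ← map_one π, ← map_sub, ← map_mul]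
      refine congrArg π (Subtype.ext ?_)
      change qPoch (s ^ 2) p (k + 1) / qPoch p p (k + 1) * (1 - p ^ (k + 1)) =
        qPoch (s ^ 2) p k / qPoch p p k * (1 - s ^ 2 * p ^ k)
      have e1 : qPoch p p k ≠ 0 := qPoch_ne_zero fun i _ => by
        rw [← pow_succ']
        exact h.one_sub_pow_ne_zero hd0 i.succ_ne_zero
      have e2 : 1 - p * p ^ k ≠ 0 := by
        rw [← pow_succ']
        exact h.one_sub_pow_ne_zero hd0 k.succ_ne_zero
      rw [qPoch_succ, qPoch_succ, pow_succ' p k]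
      generalize 1 - p * p ^ k = x at *
      generalize 1 - s ^ 2 * p ^ k = x'
      field_simp) (N / m)
  rw [Nat.div_add_mod'] at hsum
  simp only [← map_pow, ← map_one π, ← map_sub, ← map_mul, ← map_sum] at hsum
  obtain ⟨y, hy, e1⟩ := (hπ _).1 hsum
  refine ⟨y - z * wpValue s p N * (s ^ 2 * (2 + 2) - 2 * s * (1 + s ^ 2)), ?_, ?_⟩
  · refine sub_mem hy (mul_mem (mul_mem hz hV) ?_)
    have h2A : (2 : K) ∈ A := natCast_mem A 2
    exact sub_mem (mul_mem (pow_mem hs 2) (add_mem h2A h2A))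
      (mul_mem (mul_mem h2A hs) (add_mem (one_mem A) (pow_mem hs 2)))
  · have e2 : ∑ k ∈ Finset.range (N + 1), wpTerm s p k = φ * y := by
      rw [← e1]
      push_cast
      rfl
    rw [wpDefect, e2, haN, hw, e]
    ring

theorem exists_wpDefect_eq_pow_mul (h : LocalData A φ Q m) {d : ℕ} (hd : Nat.Coprime d m)
    {t : ℤ} {N : ℕ} (hN : t + d * N = m) (hNm : N < m) (ht : ∀ j : ℤ, t + d * j ≠ 0)
    {s : K} (hs : s ∈ A) (hst : s ^ 2 = Q ^ t) (h1 : 1 + s ^ 2 ≠ 0) (h2 : (2 : K) ≠ 0) :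
    ∃ y ∈ A, wpDefect s (Q ^ (d : ℤ)) N = φ ^ 3 * y := by
  have hQ := h.base_ne_zero
  have hm := h.one_lt
  have hd0 : d ≠ 0 := by
    rintro rfl
    rw [Nat.coprime_zero_left] at hd
    omega
  have hV : wpValue s (Q ^ (d : ℤ)) N ∈ A := by
    rw [wpValue, hst]
    exact h.closedForm_mem hd t N ⟨1, by rw [hN, mul_one]⟩ (hst ▸ h1)
  obtain ⟨z, hz, e⟩ := h.exists_eq_mul
  have hb : (s ^ 2)⁻¹ ∈ A := by
    rw [hst, ← zpow_neg]
    exact h.zpow_mem _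
  have haz : ∀ k : ℤ, s ^ 2 * (Q ^ (d : ℤ)) ^ k = Q ^ (t + d * k) := fun k => by
    rw [hst, ← zpow_mul, ← zpow_add₀ hQ]
  have haN : s ^ 2 * (Q ^ (d : ℤ)) ^ N = Q ^ (m : ℤ) := by
    rw [← zpow_natCast (Q ^ (d : ℤ)) N, haz, hN]
  have hs0 : s ≠ 0 := by
    rintro rfl
    rw [zero_pow two_ne_zero] at hst
    exact zpow_ne_zero _ hQ hst.symm
  have hzero := wpPoly_eq_zero hs0 (zpow_ne_zero (d : ℤ) hQ)
    (fun j => by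
      rw [← pow_succ']
      exact h.one_sub_pow_ne_zero hd0 j.succ_ne_zero)
    (fun j => by
      rw [haz]
      exact sub_ne_zero.2 (h.zpow_ne_one _ (ht j)).symm) h1 N
  rw [← wpValue, haN] at hzero
  have htwo := wpPoly_two (s := s) (N := N)
    fun i _ => h.one_sub_pow_ne_zero hd0 i.succ_ne_zero
  have hinv := prod_mem (S := A) (t := Finset.range N)
    (f := fun i => ((1 - (Q ^ (d : ℤ)) ^ (i + 1))⁻¹) ^ 4) fun i hi =>
      pow_mem (h.inv_one_sub_pow_mem hd fun hdvd => by
        have := Nat.le_of_dvd (by omega) hdvd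
        have := Finset.mem_range.1 hi
        omega) 4
  have hprod : (∏ i ∈ Finset.range N, ((1 - (Q ^ (d : ℤ)) ^ (i + 1))⁻¹) ^ 4) *
      ∏ i ∈ Finset.range N, (1 - (Q ^ (d : ℤ)) ^ (i + 1)) ^ 4 = 1 := by
    rw [← Finset.prod_mul_distrib]
    refine Finset.prod_eq_one fun i _ => ?_
    rw [← mul_pow, inv_mul_cancel₀ (h.one_sub_pow_ne_zero hd0 i.succ_ne_zero), one_pow]
  have hp' : (Q ^ (d : ℤ))⁻¹ ∈ A := by
    rw [← zpow_neg]
    exact h.zpow_mem _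
  have hp0 : Q ^ (d : ℤ) ≠ 0 := zpow_ne_zero _ hQ
  have hp : Q ^ (d : ℤ) ∈ A := h.zpow_mem _
  generalize Q ^ (d : ℤ) = p at *
  generalize wpValue s p N = V at *
  have hx : Q ^ (m : ℤ) ∈ A := h.zpow_mem _
  have hx' : (Q ^ (m : ℤ))⁻¹ ∈ A := by
    rw [← zpow_neg]
    exact h.zpow_mem _
  have hx0 : Q ^ (m : ℤ) ≠ 0 := zpow_ne_zero _ hQ
  generalize Q ^ (m : ℤ) = x at *
  obtain ⟨P, hPdef⟩ : ∃ P : A[X],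
    P = wpPoly (C ⟨s, hs⟩) (C ⟨_, hb⟩) (C ⟨p, hp⟩) (C ⟨V, hV⟩) X N := ⟨_, rfl⟩
  have hP : (C (⟨φ, h.mem⟩ : A)) ∣ P := by
    rw [hPdef]
    refine dvd_wpPoly ?_ ?_ ⟨C ⟨z, hz⟩, ?_⟩ ?_ _ _
    · rw [← map_ofNat C 2]
      refine (isUnit_of_inv_mem (x := (2 : A)) h2 ?_).map _
      have h3 := h.inv_mem 2 two_ne_zero 0 (zero_mem A)
      rw [mul_zero, add_zero] at h3
      exact h3
    · rw [← map_pow, ← map_mul, ← map_one C]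
      exact congrArg C (Subtype.ext (inv_mul_cancel₀ (pow_ne_zero 2 hs0)))
    · rw [← map_pow, ← map_pow, ← map_mul, ← map_mul, ← map_one C, ← map_sub]
      refine congrArg C (Subtype.ext ?_)
      change 1 - s ^ 2 * p ^ N = φ * z
      rw [haN, e]
    · exact (isUnit_of_inv_mem (x := (⟨p, hp⟩ : A)) hp0 hp').map _
  obtain ⟨P', hP'⟩ := hP
  have heval : ∀ u : A, wpPoly s (s ^ 2)⁻¹ p V u N = φ * (P'.eval u : A) := fun u => by
    have e1 : P.eval u = ⟨φ, h.mem⟩ * P'.eval u := by rw [hP', eval_mul, eval_C]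
    have e2 := congrArg A.subtype e1
    rw [← coe_evalRingHom, hPdef, map_wpPoly, map_wpPoly] at e2
    simpa using e2
  have h0 : P'.eval (⟨x + x⁻¹, add_mem hx hx'⟩ : A) = 0 := by
    have := heval ⟨x + x⁻¹, add_mem hx hx'⟩
    rw [hzero] at this
    exact Subtype.ext ((mul_eq_zero.1 this.symm).resolve_left h.ne_zero)
  obtain ⟨c, hc⟩ := sub_dvd_eval_sub (2 : A) ⟨x + x⁻¹, add_mem hx hx'⟩ P'
  rw [h0, sub_zero] at hc
  have hev := heval 2
  rw [hc] at hev
  refine ⟨(∏ i ∈ Finset.range N, ((1 - p ^ (i + 1))⁻¹) ^ 4) * (-x⁻¹ * z ^ 2 * c),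
    mul_mem hinv (mul_mem (mul_mem (neg_mem hx') (pow_mem hz 2)) c.2), ?_⟩
  have e3 : (2 : K) - (x + x⁻¹) = -x⁻¹ * (φ * z) ^ 2 := by
    rw [← e]
    field_simp
    ring
  have e4 : wpPoly s (s ^ 2)⁻¹ p V 2 N = φ * ((2 - (x + x⁻¹)) * c) := hev
  rw [htwo, e3] at e4
  calc wpDefect s p N = (∏ i ∈ Finset.range N, ((1 - p ^ (i + 1))⁻¹) ^ 4) *
        ((∏ i ∈ Finset.range N, (1 - p ^ (i + 1)) ^ 4) * wpDefect s p N) := by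
        rw [← mul_assoc, hprod, one_mul]
    _ = _ := by
        rw [e4]
        ring

end LocalData

end Local

section Localization

/-- The localization of `ℚ[X]` at the elements coprime to `Φ`, inside `ℚ(X)`. -/
noncomputable def coprimeSubring (Φ : ℚ[X]) : Subring (RatFunc ℚ) where
  carrier := {x | ∃ f g : ℚ[X], IsCoprime Φ g ∧
    x * algebraMap ℚ[X] (RatFunc ℚ) g = algebraMap ℚ[X] (RatFunc ℚ) f}
  mul_mem' := by
    rintro x y ⟨f, g, hg, e⟩ ⟨f', g', hg', e'⟩
    refine ⟨f * f', g * g', hg.mul_right hg', ?_⟩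
    rw [map_mul, map_mul, ← e, ← e']
    ring
  one_mem' := ⟨1, 1, isCoprime_one_right, by simp⟩
  add_mem' := by
    rintro x y ⟨f, g, hg, e⟩ ⟨f', g', hg', e'⟩
    refine ⟨f * g' + f' * g, g * g', hg.mul_right hg', ?_⟩
    rw [map_add, map_mul, map_mul, map_mul, ← e, ← e']
    ring
  zero_mem' := ⟨0, 1, isCoprime_one_right, by simp⟩
  neg_mem' := by
    rintro x ⟨f, g, hg, e⟩
    exact ⟨-f, g, hg, by rw [map_neg, ← e, neg_mul]⟩

lemma algebraMap_mem_coprimeSubring (Φ f : ℚ[X]) :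
    algebraMap ℚ[X] (RatFunc ℚ) f ∈ coprimeSubring Φ :=
  ⟨f, 1, isCoprime_one_right, by simp⟩

lemma inv_algebraMap_mem_coprimeSubring {Φ g : ℚ[X]} (hg : IsCoprime Φ g) :
    (algebraMap ℚ[X] (RatFunc ℚ) g)⁻¹ ∈ coprimeSubring Φ := by
  by_cases h : g = 0
  · rw [h, map_zero, inv_zero]
    exact zero_mem _
  · refine ⟨1, g, hg, ?_⟩
    rw [map_one, inv_mul_cancel₀]
    exact (map_ne_zero_iff _ (IsFractionRing.injective ℚ[X] (RatFunc ℚ))).2 h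

lemma ratCongr_pow_of_mem {Φ : ℚ[X]} {y : RatFunc ℚ} (hy : y ∈ coprimeSubring Φ) (e : ℕ) :
    ratCongr (Φ ^ e) (algebraMap ℚ[X] (RatFunc ℚ) Φ ^ e * y) := by
  obtain ⟨f, g, hg, h⟩ := hy
  exact ⟨f, g, hg.pow_left, by rw [map_pow, mul_assoc, h]⟩

lemma ratCongr_iff {M : ℚ[X]} {x : RatFunc ℚ} :
    ratCongr M x ↔ M ∣ x.num ∧ IsCoprime M x.denom := by
  have hinj := IsFractionRing.injective ℚ[X] (RatFunc ℚ)
  have hd : algebraMap ℚ[X] (RatFunc ℚ) x.denom ≠ 0 :=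
    (map_ne_zero_iff _ hinj).2 x.denom_ne_zero
  have hx : x * algebraMap ℚ[X] (RatFunc ℚ) x.denom = algebraMap ℚ[X] (RatFunc ℚ) x.num :=
    ((div_eq_iff hd).1 x.num_div_denom).symm
  constructor
  · rintro ⟨f, g, hg, h⟩
    have e : x.num * g = M * f * x.denom := hinj <| by
      rw [map_mul, map_mul, map_mul, ← h, ← hx]
      ring
    have hdg : x.denom ∣ g :=
      x.isCoprime_num_denom.symm.dvd_of_dvd_mul_left (e ▸ dvd_mul_left _ _)
    exact ⟨hg.dvd_of_dvd_mul_right (e ▸ (dvd_mul_right M f).mul_right _),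
      hg.of_isCoprime_of_dvd_right hdg⟩
  · rintro ⟨⟨f, hf⟩, h⟩
    exact ⟨f, x.denom, h, by rw [hx, hf, map_mul]⟩

lemma ratCongr_prod {ι : Type*} {S : Finset ι} {M : ι → ℚ[X]} {x : RatFunc ℚ}
    (hM : (S : Set ι).Pairwise (Function.onFun IsCoprime M)) (h : ∀ i ∈ S, ratCongr (M i) x) :
    ratCongr (∏ i ∈ S, M i) x :=
  ratCongr_iff.2 ⟨Finset.prod_dvd_of_coprime hM fun i hi => (ratCongr_iff.1 (h i hi)).1,
    IsCoprime.prod_left fun i hi => (ratCongr_iff.1 (h i hi)).2⟩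

lemma isCoprime_cyclotomic_X_pow_sub_one {m j : ℕ} (hm : 0 < m) (hj : ¬ m ∣ j) :
    IsCoprime (cyclotomic m ℚ) (X ^ j - 1 : ℚ[X]) := by
  refine ((cyclotomic.irreducible_rat hm).isCoprime_or_dvd _).resolve_right fun hdvd => hj ?_
  have hζ := Complex.isPrimitiveRoot_exp m hm.ne'
  have h0 : aeval (Complex.exp (2 * Real.pi * Complex.I / m)) (cyclotomic m ℚ) = 0 := by
    have : NeZero (m : ℂ) := ⟨Nat.cast_ne_zero.2 hm.ne'⟩
    rw [aeval_def, eval₂_eq_eval_map, map_cyclotomic]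
    exact isRoot_cyclotomic_iff.2 hζ
  have h1 := aeval_eq_zero_of_dvd_aeval_eq_zero hdvd h0
  simp only [map_sub, map_pow, aeval_X, map_one] at h1
  exact hζ.dvd_of_pow_eq_one j (sub_eq_zero.1 h1)

lemma isCoprime_cyclotomic_X {m : ℕ} (hm : 0 < m) : IsCoprime (cyclotomic m ℚ) X := by
  obtain ⟨g, hg⟩ := cyclotomic.dvd_X_pow_sub_one m ℚ
  obtain ⟨l, rfl⟩ : ∃ l, m = l + 1 := ⟨m - 1, by omega⟩
  exact ⟨-g, X ^ l, by linear_combination hg⟩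

lemma isCoprime_comp {f g : ℚ[X]} (h : IsCoprime f g) (k : ℚ[X]) :
    IsCoprime (f.comp k) (g.comp k) := h.map (compRingHom k)

lemma ratFunc_X_zpow_ne_one {j : ℤ} (hj : j ≠ 0) : (RatFunc.X : RatFunc ℚ) ^ j ≠ 1 := by
  have key : ∀ k : ℕ, k ≠ 0 → (RatFunc.X : RatFunc ℚ) ^ k ≠ 1 := fun k hk h => by
    rw [← RatFunc.algebraMap_X, ← map_pow, ← map_one (algebraMap ℚ[X] (RatFunc ℚ))] at h
    have := congrArg natDegree (IsFractionRing.injective ℚ[X] (RatFunc ℚ) h)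
    rw [natDegree_X_pow, natDegree_one] at this
    exact hk this
  obtain ⟨k, rfl | rfl⟩ := j.eq_nat_or_neg
  · rw [zpow_natCast]
    exact key k (by simpa using hj)
  · rw [zpow_neg, zpow_natCast, ne_eq, inv_eq_one]
    exact key k (by simpa using hj)

theorem localData_cyclotomic {m : ℕ} (hm : 1 < m) :
    LocalData (coprimeSubring ((cyclotomic m ℚ).comp (X ^ 2)))
      (algebraMap ℚ[X] (RatFunc ℚ) ((cyclotomic m ℚ).comp (X ^ 2))) (RatFunc.X ^ 2) m := by
  have hm0 : 0 < m := by omega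
  have hXA : (RatFunc.X : RatFunc ℚ) ^ 2 = algebraMap ℚ[X] (RatFunc ℚ) (X ^ 2) := by
    rw [map_pow, RatFunc.algebraMap_X]
  have hmem : (RatFunc.X : RatFunc ℚ) ^ 2 ∈ coprimeSubring ((cyclotomic m ℚ).comp (X ^ 2)) := by
    rw [hXA]
    exact algebraMap_mem_coprimeSubring _ _
  have hinv : ((RatFunc.X : RatFunc ℚ) ^ 2)⁻¹ ∈
      coprimeSubring ((cyclotomic m ℚ).comp (X ^ 2)) := by
    rw [hXA]
    have := isCoprime_comp (isCoprime_cyclotomic_X hm0) (X ^ 2)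
    rw [X_comp] at this
    exact inv_algebraMap_mem_coprimeSubring this
  have hz : ∀ j : ℤ, ((RatFunc.X : RatFunc ℚ) ^ 2) ^ j ∈
      coprimeSubring ((cyclotomic m ℚ).comp (X ^ 2)) := fun j => by
    obtain ⟨k, rfl | rfl⟩ := j.eq_nat_or_neg
    · rw [zpow_natCast]
      exact pow_mem hmem k
    · rw [zpow_neg, zpow_natCast, ← inv_pow]
      exact pow_mem hinv k
  have hX0 : (RatFunc.X : RatFunc ℚ) ^ 2 ≠ 0 := pow_ne_zero _ RatFunc.X_ne_zero
  have hsub : ∀ j : ℕ, 1 - ((RatFunc.X : RatFunc ℚ) ^ 2) ^ (j : ℤ) =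
      -algebraMap ℚ[X] (RatFunc ℚ) ((X ^ j - 1 : ℚ[X]).comp (X ^ 2)) := fun j => by
    simp
  have hone : ∀ j : ℤ, j ≠ 0 → ((RatFunc.X : RatFunc ℚ) ^ 2) ^ j ≠ 1 := fun j hj => by
    rw [← zpow_natCast, ← zpow_mul]
    exact ratFunc_X_zpow_ne_one (by simpa using hj)
  have hdvd : ∃ c ∈ coprimeSubring ((cyclotomic m ℚ).comp (X ^ 2)),
      1 - ((RatFunc.X : RatFunc ℚ) ^ 2) ^ (m : ℤ) =
        algebraMap ℚ[X] (RatFunc ℚ) ((cyclotomic m ℚ).comp (X ^ 2)) * c := by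
    obtain ⟨g, hg⟩ := cyclotomic.dvd_X_pow_sub_one m ℚ
    refine ⟨-algebraMap ℚ[X] (RatFunc ℚ) (g.comp (X ^ 2)),
      neg_mem (algebraMap_mem_coprimeSubring _ _), ?_⟩
    rw [hsub, hg, mul_comp, map_mul, mul_neg]
  refine ⟨hm, hX0, hz, hone, algebraMap_mem_coprimeSubring _ _, ?_, ?_, ?_, hdvd⟩
  · intro h
    obtain ⟨c, -, e⟩ := hdvd
    rw [h, zero_mul, sub_eq_zero] at e
    exact hone m (by omega) e.symm
  · rintro e he y ⟨f, g, hg, h⟩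
    by_cases h0 : (e : RatFunc ℚ) + algebraMap ℚ[X] (RatFunc ℚ)
        ((cyclotomic m ℚ).comp (X ^ 2)) * y = 0
    · rw [h0, inv_zero]
      exact zero_mem _
    refine ⟨g, C (e : ℚ) * g + (cyclotomic m ℚ).comp (X ^ 2) * f, ?_, ?_⟩
    · refine IsCoprime.add_mul_left_right (IsCoprime.mul_right ?_ hg) f
      exact ⟨0, C (e : ℚ)⁻¹, by
        rw [zero_mul, zero_add, ← C_mul, inv_mul_cancel₀ (by simpa using he), C_1]⟩
    · rw [map_add, map_mul, map_mul, ← h, inv_mul_eq_iff_eq_mul₀ h0]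
      simp only [map_natCast]
      ring
  · have key : ∀ k : ℕ, ¬ m ∣ k → (1 - ((RatFunc.X : RatFunc ℚ) ^ 2) ^ (k : ℤ))⁻¹ ∈
        coprimeSubring ((cyclotomic m ℚ).comp (X ^ 2)) := fun k hk => by
      rw [hsub, inv_neg]
      exact neg_mem (inv_algebraMap_mem_coprimeSubring
        (isCoprime_comp (isCoprime_cyclotomic_X_pow_sub_one hm0 hk) _))
    intro j hj
    obtain ⟨k, rfl | rfl⟩ := j.eq_nat_or_neg
    · exact key k (by exact_mod_cast hj)
    · have h1 : 1 - ((RatFunc.X : RatFunc ℚ) ^ 2) ^ (-(k : ℤ)) =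
          -((RatFunc.X : RatFunc ℚ) ^ 2) ^ (-(k : ℤ)) *
            (1 - ((RatFunc.X : RatFunc ℚ) ^ 2) ^ (k : ℤ)) := by
        rw [neg_mul, mul_sub, ← zpow_add₀ hX0, neg_add_cancel, zpow_zero]
        ring
      rw [h1, mul_inv, inv_neg, ← zpow_neg, neg_neg]
      refine mul_mem (neg_mem (hz _)) (key k fun h => hj ?_)
      rw [dvd_neg]
      exact_mod_cast h

end Localization

section Assembly

lemma summand_eq_wpTerm {K : Type*} [Field K] {q : K} (hq : q ≠ 0) (d k : ℕ) (t : ℤ) :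
    qInt (q ^ 2) (2 * (d : ℤ) * k + t) * qInt q (2 * (d : ℤ) * k + t) ^ 2 *
        qPoch (q ^ (2 * t)) (q ^ (2 * (d : ℤ))) k ^ 4 /
        qPoch (q ^ (2 * (d : ℤ))) (q ^ (2 * (d : ℤ))) k ^ 4 * q ^ (-4 * t * k) =
      (1 - q ^ 2)⁻¹ * (1 - q)⁻¹ ^ 2 * wpTerm (q ^ t) ((q ^ 2) ^ (d : ℤ)) k := by
  have e1 : (q ^ 2) ^ (d : ℤ) = q ^ (2 * (d : ℤ)) := by
    rw [← zpow_natCast q 2, ← zpow_mul, Nat.cast_ofNat]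
  have e2 : q ^ (2 * t) = (q ^ t) ^ 2 := by
    rw [← zpow_natCast (q ^ t), ← zpow_mul, mul_comm, Nat.cast_ofNat]
  have e3 : q ^ (2 * (d : ℤ) * k + t) = q ^ t * (q ^ (2 * (d : ℤ))) ^ k := by
    rw [add_comm, zpow_add₀ hq, zpow_mul, zpow_natCast]
  have e4 : (q ^ 2) ^ (2 * (d : ℤ) * k + t) = (q ^ t * (q ^ (2 * (d : ℤ))) ^ k) ^ 2 := by
    rw [← e3, ← zpow_natCast, ← zpow_natCast, zpow_comm]
  have e5 : q ^ (-4 * t * k) = (((q ^ t) ^ 2)⁻¹) ^ (2 * k) := by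
    rw [← zpow_natCast (q ^ t), ← zpow_mul, ← zpow_neg, ← zpow_natCast, ← zpow_mul]
    congr 1
    push_cast
    ring
  rw [qInt, qInt, e1, e2, e3, e4, e5, wpTerm, div_pow, div_pow]
  generalize q ^ t * (q ^ (2 * (d : ℤ))) ^ k = z
  simp only [div_eq_mul_inv, inv_pow]
  ring

lemma closedForm_eq {K : Type*} [Field K] {q : K} (hq : q ≠ 0) {n d N : ℕ} {t : ℤ}
    (hN : t + d * N = n) :
    -(2 * qInt q t ^ 2 * qInt (q ^ 2) (n : ℤ) * qPoch (q ^ (4 * t)) (q ^ (2 * (d : ℤ))) N) /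
          ((1 + q ^ (2 * t)) * qPoch (q ^ (2 * (d : ℤ))) (q ^ (2 * (d : ℤ))) N) *
        q ^ (t - 2 * t * (N : ℤ)) =
      (1 - q ^ 2)⁻¹ * (1 - q)⁻¹ ^ 2 * ((1 - (q ^ t) ^ 2 * ((q ^ 2) ^ (d : ℤ)) ^ N) *
        wpValue (q ^ t) ((q ^ 2) ^ (d : ℤ)) N *
          ((q ^ t) ^ 2 * (2 + 2) - 2 * q ^ t * (1 + (q ^ t) ^ 2))) := by
  have e1 : (q ^ 2) ^ (d : ℤ) = q ^ (2 * (d : ℤ)) := by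
    rw [← zpow_natCast q 2, ← zpow_mul, Nat.cast_ofNat]
  have e2 : q ^ (2 * t) = (q ^ t) ^ 2 := by
    rw [← zpow_natCast (q ^ t), ← zpow_mul, mul_comm, Nat.cast_ofNat]
  have e3 : q ^ (4 * t) = ((q ^ t) ^ 2) ^ 2 := by
    rw [← pow_mul, ← zpow_natCast (q ^ t), ← zpow_mul, mul_comm]
    norm_num
  have e4 : (q ^ 2) ^ (n : ℤ) = (q ^ t) ^ 2 * (q ^ (2 * (d : ℤ))) ^ N := by
    rw [← e2, ← zpow_natCast (q ^ (2 * (d : ℤ))), ← zpow_mul, ← zpow_add₀ hq, ← hN,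
      ← zpow_natCast q 2, ← zpow_mul]
    congr 1
    push_cast
    ring
  have e5 : q ^ (t - 2 * t * (N : ℤ)) = q ^ t * (((q ^ t) ^ 2) ^ N)⁻¹ := by
    rw [← zpow_natCast (q ^ t), ← zpow_mul, ← zpow_natCast, ← zpow_mul, ← zpow_neg,
      ← zpow_add₀ hq]
    congr 1
    push_cast
    ring
  rw [qInt, qInt, e1, e2, e3, e4, e5, wpValue, div_pow]
  simp only [div_eq_mul_inv, mul_inv, inv_pow]
  ring

lemma sum_X_pow_mul_cyclotomic_sq {n : ℕ} (hn : 1 < n) :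
    (∑ i ∈ Finset.range n, (X : ℚ[X]) ^ (2 * i)) * ((cyclotomic n ℚ).comp (X ^ 2)) ^ 2 =
      ∏ m ∈ n.divisors.erase 1, (cyclotomic m ℚ).comp (X ^ 2) ^ (if m = n then 3 else 1) := by
  have h1 := congrArg (compRingHom (X ^ 2 : ℚ[X]))
    (prod_cyclotomic_eq_geom_sum (by omega : 0 < n) ℚ)
  rw [map_prod, map_sum] at h1
  simp only [coe_compRingHom_apply, pow_comp, X_comp, ← pow_mul] at h1
  have hmem : n ∈ n.divisors.erase 1 :=
    Finset.mem_erase.2 ⟨hn.ne', Nat.mem_divisors_self n (by omega)⟩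
  have h2 : ∏ m ∈ (n.divisors.erase 1).erase n,
        (cyclotomic m ℚ).comp (X ^ 2) ^ (if m = n then 3 else 1) =
      ∏ m ∈ (n.divisors.erase 1).erase n, (cyclotomic m ℚ).comp (X ^ 2) :=
    Finset.prod_congr rfl fun m hm => by rw [if_neg (Finset.ne_of_mem_erase hm), pow_one]
  rw [← h1, ← Finset.mul_prod_erase _ _ hmem, ← Finset.mul_prod_erase _ _ hmem, if_pos rfl, h2]
  ring

end Assembly

/-- Generalization of Theorem 2 (Theorem 6, eq. (4.5) of the paper). -/
theorem stmt13 (n : ℕ) (hn : 1 < n) (d : ℕ) (hd : 2 ≤ d) (t : ℤ)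
    (htd : Int.gcd t (d : ℤ) = 1) (hmod : (n : ℤ) ≡ t [ZMOD (d : ℤ)])
    (ht1 : (n : ℤ) + d - n * d ≤ t) (ht2 : t ≤ (n : ℤ)) :
    let q : RatFunc ℚ := RatFunc.X
    let N : ℕ := (((n : ℤ) - t) / (d : ℤ)).toNat
    ratCongr ((∑ i ∈ Finset.range n, (X : ℚ[X]) ^ (2 * i)) *
        ((cyclotomic n ℚ).comp (X ^ 2)) ^ 2)
      ((∑ k ∈ Finset.range (N + 1),
          qInt (q ^ 2) (2 * (d : ℤ) * k + t) * qInt q (2 * (d : ℤ) * k + t) ^ 2 *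
            qPoch (q ^ (2 * t)) (q ^ (2 * (d : ℤ))) k ^ 4 /
            qPoch (q ^ (2 * (d : ℤ))) (q ^ (2 * (d : ℤ))) k ^ 4 * q ^ (-4 * t * k)) -
        -(2 * qInt q t ^ 2 * qInt (q ^ 2) (n : ℤ) * qPoch (q ^ (4 * t)) (q ^ (2 * (d : ℤ))) N) /
            ((1 + q ^ (2 * t)) * qPoch (q ^ (2 * (d : ℤ))) (q ^ (2 * (d : ℤ))) N) *
          q ^ (t - 2 * t * (((n : ℤ) - t) / (d : ℤ)))) := by
  intro q N
  have hq : q ≠ 0 := RatFunc.X_ne_zero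
  obtain ⟨c, hc⟩ := (Int.modEq_iff_dvd.1 hmod.symm)
  have hd0 : (d : ℤ) ≠ 0 := by omega
  have hdiv : ((n : ℤ) - t) / (d : ℤ) = c := by rw [hc, Int.mul_ediv_cancel_left _ hd0]
  have hc0 : 0 ≤ c := by
    rw [← hdiv]
    exact Int.ediv_nonneg (by omega) (by omega)
  have hNc : (N : ℤ) = c := by
    change ((((n : ℤ) - t) / (d : ℤ)).toNat : ℤ) = c
    rw [hdiv, Int.toNat_of_nonneg hc0]
  have hN : t + d * N = n := by
    rw [hNc]
    linear_combination -hc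
  have hNn : N < n := by
    have : (d : ℤ) * N ≤ d * (n - 1) := by linarith
    have := le_of_mul_le_mul_left this (by omega)
    omega
  have htd' : IsCoprime t (d : ℤ) := Int.isCoprime_iff_gcd_eq_one.2 htd
  have hdn : Nat.Coprime d n := by
    rw [← Nat.isCoprime_iff_coprime, ← hN]
    exact htd'.symm.add_mul_left_right _
  have ht : ∀ j : ℤ, t + d * j ≠ 0 := fun j h => by
    have h1 : (d : ℤ) ∣ t := ⟨-j, by linear_combination h⟩
    have h2 := Int.isUnit_iff.1 (htd'.isUnit_of_dvd' h1 dvd_rfl)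
    omega
  have ht0 : t ≠ 0 := by simpa using ht 0
  have hst : (q ^ t) ^ 2 = (q ^ 2) ^ t := by rw [← zpow_natCast, ← zpow_natCast, zpow_comm]
  have h1s : 1 + (q ^ t) ^ 2 ≠ 0 := fun h => by
    refine ratFunc_X_zpow_ne_one (j := t * 4) (by omega) ?_
    have h4 : (q ^ t) ^ 4 = 1 := by linear_combination ((q ^ t) ^ 2 - 1) * h
    rw [zpow_mul]
    exact_mod_cast h4
  have key : (∑ k ∈ Finset.range (N + 1),
      qInt (q ^ 2) (2 * (d : ℤ) * k + t) * qInt q (2 * (d : ℤ) * k + t) ^ 2 *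
        qPoch (q ^ (2 * t)) (q ^ (2 * (d : ℤ))) k ^ 4 /
        qPoch (q ^ (2 * (d : ℤ))) (q ^ (2 * (d : ℤ))) k ^ 4 * q ^ (-4 * t * k)) -
      -(2 * qInt q t ^ 2 * qInt (q ^ 2) (n : ℤ) * qPoch (q ^ (4 * t)) (q ^ (2 * (d : ℤ))) N) /
          ((1 + q ^ (2 * t)) * qPoch (q ^ (2 * (d : ℤ))) (q ^ (2 * (d : ℤ))) N) *
        q ^ (t - 2 * t * (((n : ℤ) - t) / (d : ℤ))) =
      (1 - q ^ 2)⁻¹ * (1 - q)⁻¹ ^ 2 * wpDefect (q ^ t) ((q ^ 2) ^ (d : ℤ)) N := by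
    rw [hdiv, ← hNc, closedForm_eq hq hN,
      Finset.sum_congr rfl fun k _ => summand_eq_wpTerm hq d k t, ← Finset.mul_sum, ← mul_sub,
      wpDefect]
  rw [key, sum_X_pow_mul_cyclotomic_sq hn]
  refine ratCongr_prod (fun m _ l _ hml => ?_) fun m hm => ?_
  · exact (isCoprime_comp (cyclotomic.isCoprime_rat hml) _).pow
  obtain ⟨hm1, hm⟩ := Finset.mem_erase.1 hm
  have hmn := Nat.dvd_of_mem_divisors hm
  have hm : 1 < m := by
    have := Nat.pos_of_dvd_of_pos hmn (by omega)
    omega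
  have hdm := hdn.coprime_dvd_right hmn
  have h := localData_cyclotomic hm
  have hqA : q ∈ coprimeSubring ((cyclotomic m ℚ).comp (X ^ 2)) := by
    rw [show q = algebraMap ℚ[X] (RatFunc ℚ) X from RatFunc.algebraMap_X.symm]
    exact algebraMap_mem_coprimeSubring _ _
  have hs : q ^ t ∈ coprimeSubring ((cyclotomic m ℚ).comp (X ^ 2)) := by
    have hinv : q⁻¹ ∈ coprimeSubring ((cyclotomic m ℚ).comp (X ^ 2)) := by
      convert mul_mem hqA (h.zpow_mem (-1)) using 1
      rw [zpow_neg_one]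
      change q⁻¹ = q * (q ^ 2)⁻¹
      field_simp
    obtain ⟨k, rfl | rfl⟩ := t.eq_nat_or_neg
    · rw [zpow_natCast]
      exact pow_mem hqA k
    · rw [zpow_neg, zpow_natCast, ← inv_pow]
      exact pow_mem hinv k
  have hu : (1 - q ^ 2)⁻¹ ∈ coprimeSubring ((cyclotomic m ℚ).comp (X ^ 2)) := by
    have := h.inv_one_sub_mem 1 (by
      intro h
      have := Int.le_of_dvd one_pos h
      omega)
    rwa [zpow_one] at this
  have hu' : (1 - q)⁻¹ ∈ coprimeSubring ((cyclotomic m ℚ).comp (X ^ 2)) := by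
    have h1 : 1 + q ≠ 0 := fun h => ratFunc_X_zpow_ne_one (j := 2) two_ne_zero (by
      have h2 : q ^ 2 = 1 := by linear_combination (q - 1) * h
      exact_mod_cast h2)
    convert mul_mem (add_mem (one_mem _) hqA) hu using 1
    rw [show 1 - q ^ 2 = (1 + q) * (1 - q) by ring, mul_inv, ← mul_assoc, mul_inv_cancel₀ h1,
      one_mul]
  have huu := mul_mem hu (pow_mem hu' 2)
  by_cases hmn' : m = n
  · subst hmn'
    rw [if_pos rfl]
    obtain ⟨y, hy, e⟩ := h.exists_wpDefect_eq_pow_mul hdm hN hNn ht hs hst h1s two_ne_zero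
    change wpDefect (q ^ t) ((q ^ 2) ^ (d : ℤ)) N = _ at e
    rw [e, mul_left_comm]
    exact ratCongr_pow_of_mem (mul_mem huu hy) 3
  · rw [if_neg hmn']
    obtain ⟨y, hy, e⟩ := h.exists_wpDefect_eq_mul hdm (hN ▸ Int.natCast_dvd_natCast.2 hmn) hs hst
      h1s two_ne_zero
    change wpDefect (q ^ t) ((q ^ 2) ^ (d : ℤ)) N = _ at e
    rw [e, mul_left_comm]
    simpa only [pow_one] using ratCongr_pow_of_mem (mul_mem huu hy) 1
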